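/- arXiv:1312.6320 — 3 statements merged into one kernel-verified Lean document; each statement's English description precedes it below -/
import Mathlib

section
/- Let x : ℝ³ × ℝ → ℝ³ be a twice continuously differentiable map and P : ℝ³ × ℝ → ℝ a continuously differentiable function such that ∂²_t x(a,t) = −(∇P)(x(a,t),t) for all (a,t), where ∇P is the spatial gradient of P. Assume moreover x(a,0) = a and ∂_t x(a,0) = v⁰(a) for a continuously differentiable vector field v⁰ : ℝ³ → ℝ³. Then the Cauchy invariants are conserved: for all a and all t, Σ_{k=1}^{3} ∇_a(∂_t x_k)(a,t) × ∇_a x_k(a,t) = (∇ × v⁰)(a), the curl of the initial velocity field. -/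
/-- Partial derivative of a scalar function on `ℝ³` in the `i`-th coordinate direction. -/
noncomputable def pd (i : Fin 3) (f : (Fin 3 → ℝ) → ℝ) (a : Fin 3 → ℝ) : ℝ :=
  fderiv ℝ f a (Pi.single i 1)

/-- Gradient of a scalar function on `ℝ³`. -/
noncomputable def grad (f : (Fin 3 → ℝ) → ℝ) (a : Fin 3 → ℝ) : Fin 3 → ℝ :=
  fun i => pd i f a

/-- Cross product in `ℝ³`. -/
def cross (u v : Fin 3 → ℝ) : Fin 3 → ℝ :=
  ![u 1 * v 2 - u 2 * v 1, u 2 * v 0 - u 0 * v 2, u 0 * v 1 - u 1 * v 0]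

/-- Curl of a vector field on `ℝ³`. -/
noncomputable def curl (v : (Fin 3 → ℝ) → (Fin 3 → ℝ)) (a : Fin 3 → ℝ) : Fin 3 → ℝ :=
  ![pd 1 (fun y => v y 2) a - pd 2 (fun y => v y 1) a,
    pd 2 (fun y => v y 0) a - pd 0 (fun y => v y 2) a,
    pd 0 (fun y => v y 1) a - pd 1 (fun y => v y 0) a]

section SpaceTime

variable {E : Type*} [NormedAddCommGroup E] [NormedSpace ℝ E]

theorem HasFDerivAt.comp_prodMk_left {F : Type*} [NormedAddCommGroup F] [NormedSpace ℝ F]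
    {f : E × ℝ → F} {f' : E × ℝ →L[ℝ] F} {a : E} {t : ℝ} (hf : HasFDerivAt f f' (a, t)) :
    HasFDerivAt (fun b => f (b, t)) (f'.comp (.inl ℝ E ℝ)) a :=
  hf.comp a (hasFDerivAt_prodMk_left a t)

theorem HasFDerivAt.hasDerivAt_prodMk_right {F : Type*} [NormedAddCommGroup F] [NormedSpace ℝ F]
    {f : E × ℝ → F} {f' : E × ℝ →L[ℝ] F} {a : E} {t : ℝ} (hf : HasFDerivAt f f' (a, t)) :
    HasDerivAt (fun s => f (a, s)) (f' (0, 1)) t := by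
  simpa [Function.comp_def] using (hf.comp t (hasFDerivAt_prodMk_right a t)).hasDerivAt

/-- Differentiation under the integral sign for a `C¹` integrand on a proper space. -/
theorem ContDiff.hasFDerivAt_intervalIntegral [ProperSpace E] {L : E × ℝ → ℝ}
    (hL : ContDiff ℝ 1 L) (a : E) (t₀ t₁ : ℝ) :
    HasFDerivAt (fun b => ∫ s in t₀..t₁, L (b, s))
      (∫ s in t₀..t₁, (fderiv ℝ L (a, s)).comp (.inl ℝ E ℝ)) a := by
  have hcont : Continuous fun p : E × ℝ => (fderiv ℝ L p).comp (.inl ℝ E ℝ) :=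
    (hL.continuous_fderiv one_ne_zero).clm_comp continuous_const
  obtain ⟨C, hC⟩ := ((isCompact_closedBall a 1).prod
    (isCompact_uIcc (a := t₀) (b := t₁))).exists_bound_of_continuousOn hcont.continuousOn
  refine intervalIntegral.hasFDerivAt_integral_of_dominated_of_fderiv_le
    (F' := fun b s => (fderiv ℝ L (b, s)).comp (.inl ℝ E ℝ)) (bound := fun _ => C)
    (Metric.closedBall_mem_nhds a one_pos) (.of_forall fun b => ?_) ?_ ?_
    (.of_forall fun s hs b hb => hC (b, s) ⟨hb, Set.uIoc_subset_uIcc hs⟩)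
    intervalIntegrable_const (.of_forall fun s _ b _ => ?_)
  · exact (hL.continuous.comp (by fun_prop)).aestronglyMeasurable
  · exact (hL.continuous.comp (by fun_prop)).intervalIntegrable _ _
  · exact (hcont.comp (f := fun s : ℝ => (a, s)) (by fun_prop)).aestronglyMeasurable
  · exact (hL.differentiable one_ne_zero (b, s)).hasFDerivAt.comp_prodMk_left

/-- If the time derivative of a `C¹` family of one-forms is exact, its exterior derivative is
conserved. -/
theorem fderiv_sub_fderiv_swap_eq_of_hasDerivAt [ProperSpace E] {W : E × ℝ → E →L[ℝ] ℝ}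
    {L : E × ℝ → ℝ} (hW : ContDiff ℝ 1 W) (hL : ContDiff ℝ 1 L)
    (hWL : ∀ a t, HasDerivAt (fun s => W (a, s)) ((fderiv ℝ L (a, t)).comp (.inl ℝ E ℝ)) t)
    (a : E) (t₀ t₁ : ℝ) (h k : E) :
    fderiv ℝ (fun b => W (b, t₁)) a h k - fderiv ℝ (fun b => W (b, t₁)) a k h
      = fderiv ℝ (fun b => W (b, t₀)) a h k - fderiv ℝ (fun b => W (b, t₀)) a k h := by
  have hcont (b : E) : Continuous fun s : ℝ => (fderiv ℝ L (b, s)).comp (.inl ℝ E ℝ) :=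
    ((hL.continuous_fderiv one_ne_zero).comp (by fun_prop)).clm_comp continuous_const
  have hpot (b : E) : HasFDerivAt (fun b => ∫ s in t₀..t₁, L (b, s)) (W (b, t₁) - W (b, t₀)) b := by
    rw [← intervalIntegral.integral_eq_sub_of_hasDerivAt (fun s _ => hWL b s)
      ((hcont b).intervalIntegrable _ _)]
    exact hL.hasFDerivAt_intervalIntegral b t₀ t₁
  have hd (t : ℝ) : HasFDerivAt (fun b => W (b, t)) (fderiv ℝ (fun b => W (b, t)) a) a :=
    (hW.differentiable one_ne_zero (a, t)).hasFDerivAt.comp_prodMk_left.differentiableAt.hasFDerivAt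
  have := second_derivative_symmetric hpot ((hd t₁).sub (hd t₀)) h k
  simp only [sub_apply] at this
  linarith

/-- The Weber one-form `∑ₖ ∂ₜfₖ dₐfₖ`. -/
noncomputable def weber {ι : Type*} [Fintype ι] (f : ι → E × ℝ → ℝ) (p : E × ℝ) : E →L[ℝ] ℝ :=
  ∑ k, fderiv ℝ (f k) p (0, 1) • (fderiv ℝ (f k) p).comp (.inl ℝ E ℝ)

variable {ι : Type*} [Fintype ι] {f : ι → E × ℝ → ℝ}

theorem contDiff_weber (hf : ∀ k, ContDiff ℝ 2 (f k)) : ContDiff ℝ 1 (weber f) := by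
  have h1 (k : ι) : ContDiff ℝ 1 (fderiv ℝ (f k)) := (hf k).fderiv_right (by norm_num)
  exact ContDiff.sum fun k _ => ((h1 k).clm_apply contDiff_const).smul
    ((h1 k).clm_comp contDiff_const)

theorem fderiv_weber_sub_swap (hf : ∀ k, ContDiff ℝ 2 (f k)) (a : E) (t : ℝ) (h k : E) :
    fderiv ℝ (fun b => weber f (b, t)) a h k - fderiv ℝ (fun b => weber f (b, t)) a k h
      = ∑ m, (fderiv ℝ (fun b => deriv (fun s => f m (b, s)) t) a h
            * fderiv ℝ (fun b => f m (b, t)) a k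
          - fderiv ℝ (fun b => deriv (fun s => f m (b, s)) t) a k
            * fderiv ℝ (fun b => f m (b, t)) a h) := by
  have hf' (m : ι) (p) : HasFDerivAt (f m) (fderiv ℝ (f m) p) p :=
    ((hf m).differentiable two_ne_zero p).hasFDerivAt
  have hf'' (m : ι) : HasFDerivAt (fderiv ℝ (f m)) (fderiv ℝ (fderiv ℝ (f m)) (a, t)) (a, t) :=
    ((((hf m).fderiv_right (m := 1) (by norm_num)).differentiable one_ne_zero) (a, t)).hasFDerivAt
  have hsymm (m : ι) := (hf m).contDiffAt (x := (a, t)).isSymmSndFDerivAt (by simp) (h, 0) (k, 0)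
  have hvel (m : ι) : (fun b => deriv (fun s => f m (b, s)) t)
      = fun b => fderiv ℝ (f m) (b, t) (0, 1) :=
    funext fun b => (hf' m (b, t)).hasDerivAt_prodMk_right.deriv
  have hV (m : ι) := ((hf'' m).comp_prodMk_left).clm_apply
    (hasFDerivAt_const ((0, 1) : E × ℝ) a)
  have hJ (m : ι) := ((hf'' m).comp_prodMk_left).clm_comp
    (hasFDerivAt_const (ContinuousLinearMap.inl ℝ E ℝ) a)
  have hW := HasFDerivAt.fun_sum (u := Finset.univ) fun m _ => (hV m).smul (hJ m)
  have hW' : HasFDerivAt (fun b => weber f (b, t)) _ a := hW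
  rw [hW'.fderiv]
  simp only [sum_apply, ← Finset.sum_sub_distrib]
  refine Finset.sum_congr rfl fun m _ => ?_
  rw [hvel m, (hV m).fderiv, (hf' m (a, t)).comp_prodMk_left.fderiv]
  simp
  rw [hsymm m]
  ring

theorem hasDerivAt_weber (hf : ∀ k, ContDiff ℝ 2 (f k)) (a : E) (t : ℝ) :
    HasDerivAt (fun s => weber f (a, s))
      (∑ k, deriv (fun s => deriv (fun u => f k (a, u)) s) t
          • (fderiv ℝ (f k) (a, t)).comp (.inl ℝ E ℝ)
        + (fderiv ℝ (fun p => 1 / 2 * ∑ k, fderiv ℝ (f k) p (0, 1) ^ 2) (a, t)).comp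
          (.inl ℝ E ℝ)) t := by
  have hf' (m : ι) (p) : HasFDerivAt (f m) (fderiv ℝ (f m) p) p :=
    ((hf m).differentiable two_ne_zero p).hasFDerivAt
  have hf'' (m : ι) : HasFDerivAt (fderiv ℝ (f m)) (fderiv ℝ (fderiv ℝ (f m)) (a, t)) (a, t) :=
    ((((hf m).fderiv_right (m := 1) (by norm_num)).differentiable one_ne_zero) (a, t)).hasFDerivAt
  have hsymm (m : ι) (h : E) :=
    (hf m).contDiffAt (x := (a, t)).isSymmSndFDerivAt (by simp) (h, 0) (0, 1)
  have hvel (m : ι) : (fun s => deriv (fun u => f m (a, u)) s)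
      = fun s => fderiv ℝ (f m) (a, s) (0, 1) :=
    funext fun s => (hf' m (a, s)).hasDerivAt_prodMk_right.deriv
  have hVt (m : ι) := ((hf'' m).hasDerivAt_prodMk_right).clm_apply
    (hasDerivAt_const t ((0, 1) : E × ℝ))
  have hJ (m : ι) := ((hf'' m).hasDerivAt_prodMk_right).clm_comp
    (hasDerivAt_const t (ContinuousLinearMap.inl ℝ E ℝ))
  have hV (m : ι) := (hf'' m).clm_apply (hasFDerivAt_const ((0, 1) : E × ℝ) (a, t))
  have hK := (HasFDerivAt.fun_sum (u := Finset.univ) fun m _ => (hV m).pow 2).const_mul (1 / 2)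
  have hW := HasDerivAt.fun_sum (u := Finset.univ) fun m _ => (hVt m).smul (hJ m)
  have hW' : HasDerivAt (fun s => weber f (a, s)) _ t := hW
  refine hW'.congr_deriv ?_
  rw [hK.fderiv]
  simp only [hvel, (hVt _).deriv]
  ext h
  simp [Finset.sum_add_distrib, Finset.mul_sum]
  rw [add_comm]
  congr 1
  refine Finset.sum_congr rfl fun m _ => ?_
  rw [hsymm m]
  ring

end SpaceTime

theorem grad_apply (f : (Fin 3 → ℝ) → ℝ) (a : Fin 3 → ℝ) (i : Fin 3) :
    grad f a i = fderiv ℝ f a (Pi.single i 1) := rfl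

theorem ContinuousLinearMap.apply_eq_sum_single {ι : Type*} [Fintype ι] [DecidableEq ι]
    (g : (ι → ℝ) →L[ℝ] ℝ) (y : ι → ℝ) : g y = ∑ k, y k * g (Pi.single k 1) := by
  conv_lhs => rw [pi_eq_sum_univ' y]
  simp

theorem sum_cross_grad_grad_id_eq_curl (v : (Fin 3 → ℝ) → (Fin 3 → ℝ)) (a : Fin 3 → ℝ) :
    ∑ k : Fin 3, cross (grad (fun b => v b k) a) (grad (fun b => b k) a) = curl v a := by
  have hproj (k : Fin 3) : fderiv ℝ (fun b : Fin 3 → ℝ => b k) a = .proj k :=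
    (ContinuousLinearMap.proj (R := ℝ) (φ := fun _ : Fin 3 => ℝ) k).hasFDerivAt.fderiv
  ext i
  fin_cases i <;> simp [Fin.sum_univ_three, cross, curl, grad, pd, hproj]

/-- Conservation of the Cauchy invariants for the Lagrangian map of an ideal fluid. -/
theorem cauchy_invariants
    (x : (Fin 3 → ℝ) × ℝ → (Fin 3 → ℝ)) (P : (Fin 3 → ℝ) × ℝ → ℝ)
    (v0 : (Fin 3 → ℝ) → (Fin 3 → ℝ))
    (hx : ContDiff ℝ 2 x) (hP : ContDiff ℝ 1 P) (hv0 : ContDiff ℝ 1 v0)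
    (hmom : ∀ (a : Fin 3 → ℝ) (t : ℝ) (i : Fin 3),
      deriv (fun s => deriv (fun u => x (a, u) i) s) t
        = - pd i (fun y => P (y, t)) (x (a, t)))
    (hinit : ∀ a : Fin 3 → ℝ, x (a, 0) = a)
    (hvel : ∀ (a : Fin 3 → ℝ) (i : Fin 3), deriv (fun s => x (a, s) i) 0 = v0 a i) :
    ∀ (a : Fin 3 → ℝ) (t : ℝ),
      ∑ k : Fin 3,
          cross (grad (fun b => deriv (fun s => x (b, s) k) t) a)
            (grad (fun b => x (b, t) k) a)
        = curl v0 a := by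
  intro a t
  have hf (k : Fin 3) : ContDiff ℝ 2 fun p => x p k := contDiff_pi.1 hx k
  have hV (k : Fin 3) : ContDiff ℝ 1 fun p => fderiv ℝ (fun q => x q k) p (0, 1) :=
    ((hf k).fderiv_right (by norm_num)).clm_apply contDiff_const
  have hK : ContDiff ℝ 1 fun p : (Fin 3 → ℝ) × ℝ =>
      1 / 2 * ∑ k, fderiv ℝ (fun q => x q k) p (0, 1) ^ 2 :=
    contDiff_const.mul (ContDiff.sum fun k _ => (hV k).pow 2)
  have hPx : ContDiff ℝ 1 fun p : (Fin 3 → ℝ) × ℝ => P (x p, p.2) :=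
    hP.comp ((hx.of_le (by norm_num)).prodMk contDiff_snd)
  have hweber (b : Fin 3 → ℝ) (s : ℝ) :
      HasDerivAt (fun s => weber (fun k p => x p k) (b, s))
        ((fderiv ℝ (fun p => 1 / 2 * ∑ k, fderiv ℝ (fun q => x q k) p (0, 1) ^ 2 - P (x p, p.2))
          (b, s)).comp (.inl ℝ _ ℝ)) s := by
    refine (hasDerivAt_weber hf b s).congr_deriv ?_
    have hPd : HasFDerivAt P _ (x (b, s), s) := (hP.differentiable one_ne_zero _).hasFDerivAt
    have hxd : HasFDerivAt x _ (b, s) := (hx.differentiable two_ne_zero _).hasFDerivAt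
    have hcomp : HasFDerivAt (fun p : (Fin 3 → ℝ) × ℝ => P (x p, p.2)) _ (b, s) :=
      HasFDerivAt.comp (b, s) hPd (hxd.prodMk hasFDerivAt_snd)
    have hxk (k : Fin 3) : fderiv ℝ (fun p => x p k) (b, s)
        = (ContinuousLinearMap.proj k).comp (fderiv ℝ x (b, s)) :=
      ((hasFDerivAt_pi'.1 hxd) k).fderiv
    rw [fderiv_fun_sub (hK.differentiable one_ne_zero _) (hPx.differentiable one_ne_zero _),
      hcomp.fderiv]
    ext h
    have hsum := ((fderiv ℝ P (x (b, s), s)).comp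
      (.inl ℝ (Fin 3 → ℝ) ℝ)).apply_eq_sum_single (fderiv ℝ x (b, s) (h, 0))
    simp only [ContinuousLinearMap.comp_apply, ContinuousLinearMap.inl_apply] at hsum
    simp [hmom, pd, hPd.comp_prodMk_left.fderiv, hxk, hsum, mul_comm]
    ring
  have hcons (i j : Fin 3) := fderiv_sub_fderiv_swap_eq_of_hasDerivAt (contDiff_weber hf)
    (hK.sub hPx) hweber a 0 t (Pi.single i 1) (Pi.single j 1)
  simp only [fderiv_weber_sub_swap hf, ← grad_apply, Finset.sum_sub_distrib] at hcons
  trans ∑ k : Fin 3, cross (grad (fun b => deriv (fun s => x (b, s) k) 0) a)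
    (grad (fun b => x (b, 0) k) a)
  · ext i
    fin_cases i
    · simpa [Finset.sum_apply, cross, ← Finset.sum_sub_distrib, mul_comm] using hcons 1 2
    · simpa [Finset.sum_apply, cross, ← Finset.sum_sub_distrib, mul_comm] using hcons 2 0
    · simpa [Finset.sum_apply, cross, ← Finset.sum_sub_distrib, mul_comm] using hcons 0 1
  · simp only [hinit, hvel]
    exact sum_cross_grad_grad_id_eq_curl v0 a
end

section
/- Let Γ > 0 and let (c_s)_{s≥1} be nonnegative real numbers with c_1 ≤ Γ and, for every s ≥ 2, c_s ≤ (1/√2) Σ_{m=1}^{s−1} c_m c_{s−m} + (1/6) Σ_{l,m,n ≥ 1, l+m+n = s} c_l c_m c_n. Then for every t ≥ 0 with Γ·t < (8 − 5√2)/3, every partial sum satisfies Σ_{s=1}^{N} c_s t^s ≤ 2 − √2 for all N ≥ 1; in particular the series Σ_{s=1}^{∞} c_s t^s converges. -/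
/-- Partial sums of a Cauchy product of nonnegative sequences are bounded by the product of
partial sums; indices start at `1`. -/
theorem sum_Icc_cauchyProduct_le {a b : ℕ → ℝ} (ha : ∀ s, 1 ≤ s → 0 ≤ a s)
    (hb : ∀ s, 1 ≤ s → 0 ≤ b s) (N : ℕ) :
    ∑ s ∈ Finset.Icc 1 (N + 1), ∑ m ∈ Finset.Ioo 0 s, a m * b (s - m) ≤
      (∑ m ∈ Finset.Icc 1 N, a m) * ∑ m ∈ Finset.Icc 1 N, b m := by
  rw [Finset.sum_comm' (t' := Finset.Icc 1 N) (s' := fun m => Finset.Ioc m (N + 1))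
    (by intro x y; simp only [Finset.mem_Icc, Finset.mem_Ioo, Finset.mem_Ioc]; omega),
    Finset.sum_mul]
  refine Finset.sum_le_sum fun m hm => ?_
  rw [← Finset.mul_sum]
  refine mul_le_mul_of_nonneg_left ?_ (ha m (Finset.mem_Icc.1 hm).1)
  have hinj : Set.InjOn (fun s => s - m) (Finset.Ioc m (N + 1) : Set ℕ) := by
    intro x hx y hy hxy
    simp only [Finset.coe_Ioc, Set.mem_Ioc] at hx hy hxy
    omega
  rw [← Finset.sum_image (f := b) hinj]
  refine Finset.sum_le_sum_of_subset_of_nonneg ?_ fun s hs _ => hb s (Finset.mem_Icc.1 hs).1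
  intro k hk
  simp only [Finset.mem_image, Finset.mem_Icc, Finset.mem_Ioc] at hk hm ⊢
  omega

/-- Sums over an interval starting at `1` of nonnegative terms grow with the right end point. -/
theorem sum_Icc_le_sum_Icc_succ {a : ℕ → ℝ} (ha : ∀ s, 1 ≤ s → 0 ≤ a s) (N : ℕ) :
    ∑ s ∈ Finset.Icc 1 N, a s ≤ ∑ s ∈ Finset.Icc 1 (N + 1), a s :=
  Finset.sum_le_sum_of_subset_of_nonneg (Finset.Icc_subset_Icc_right N.le_succ)
    fun s hs _ => ha s (Finset.mem_Icc.1 hs).1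

/-- One step of the majorant iteration `S ↦ a₁ + p S² + q S³`. -/
theorem sum_Icc_succ_le_of_recurrence {a : ℕ → ℝ} {p q : ℝ} (hp : 0 ≤ p) (hq : 0 ≤ q)
    (ha : ∀ s, 1 ≤ s → 0 ≤ a s)
    (hrec : ∀ s, 2 ≤ s → a s ≤ p * ∑ m ∈ Finset.Ioo 0 s, a m * a (s - m) +
      q * ∑ l ∈ Finset.Ioo 0 s, a l * ∑ m ∈ Finset.Ioo 0 (s - l), a m * a (s - l - m))
    (N : ℕ) :
    ∑ s ∈ Finset.Icc 1 (N + 1), a s ≤ a 1 + p * (∑ s ∈ Finset.Icc 1 N, a s) ^ 2 +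
      q * (∑ s ∈ Finset.Icc 1 N, a s) ^ 3 := by
  have hd : ∀ s, 1 ≤ s → 0 ≤ ∑ m ∈ Finset.Ioo 0 s, a m * a (s - m) := fun s _ =>
    Finset.sum_nonneg fun m hm => by
      rw [Finset.mem_Ioo] at hm
      exact mul_nonneg (ha _ (by omega)) (ha _ (by omega))
  have hS : 0 ≤ ∑ s ∈ Finset.Icc 1 N, a s :=
    Finset.sum_nonneg fun s hs => ha s (Finset.mem_Icc.1 hs).1
  have h2 := sum_Icc_cauchyProduct_le ha ha N
  have h3 := (sum_Icc_cauchyProduct_le ha hd N).trans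
    (mul_le_mul_of_nonneg_left ((sum_Icc_le_sum_Icc_succ hd N).trans h2) hS)
  calc ∑ s ∈ Finset.Icc 1 (N + 1), a s
      ≤ ∑ s ∈ Finset.Icc 1 (N + 1), ((if s = 1 then a 1 else 0) +
        (p * ∑ m ∈ Finset.Ioo 0 s, a m * a (s - m) +
          q * ∑ l ∈ Finset.Ioo 0 s, a l *
            ∑ m ∈ Finset.Ioo 0 (s - l), a m * a (s - l - m))) := by
        refine Finset.sum_le_sum fun s hs => ?_
        rcases (Finset.mem_Icc.1 hs).1.eq_or_lt with rfl | h
        · simp [show Finset.Ioo 0 1 = (∅ : Finset ℕ) from rfl]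
        · simpa [h.ne'] using hrec s h
    _ = a 1 + (p * ∑ s ∈ Finset.Icc 1 (N + 1), ∑ m ∈ Finset.Ioo 0 s, a m * a (s - m) +
          q * ∑ s ∈ Finset.Icc 1 (N + 1), ∑ l ∈ Finset.Ioo 0 s, a l *
            ∑ m ∈ Finset.Ioo 0 (s - l), a m * a (s - l - m)) := by
        rw [Finset.sum_add_distrib, Finset.sum_add_distrib, ← Finset.mul_sum, ← Finset.mul_sum,
          Finset.sum_ite_eq' (Finset.Icc 1 (N + 1)), if_pos (by simp)]
    _ ≤ _ := by
        have := mul_le_mul_of_nonneg_left h2 hp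
        have := mul_le_mul_of_nonneg_left h3 hq
        linarith


/-- Generating-function bound for the elementary Fourier-space proof: if the
coefficients `c_s` satisfy `c_1 ≤ Γ` and the quadratic/cubic recurrence of bounds,
then for `Γt < (8 − 5√2)/3` all partial sums of `Σ c_s t^s` are bounded by `2 − √2`,
and the series converges. -/
theorem generating_function_bound (Γ : ℝ) (hΓ : 0 < Γ) (c : ℕ → ℝ)
    (hc : ∀ s : ℕ, 1 ≤ s → 0 ≤ c s) (h1 : c 1 ≤ Γ)
    (hrec : ∀ s : ℕ, 2 ≤ s →
      c s ≤ (1 / Real.sqrt 2) * ∑ m ∈ Finset.Ioo 0 s, c m * c (s - m)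
        + (1 / 6) * ∑ l ∈ Finset.Ioo 0 s, ∑ m ∈ Finset.Ioo 0 (s - l),
            c l * c m * c (s - l - m)) :
    ∀ t : ℝ, 0 ≤ t → Γ * t < (8 - 5 * Real.sqrt 2) / 3 →
      (∀ N : ℕ, 1 ≤ N → ∑ s ∈ Finset.Icc 1 N, c s * t ^ s ≤ 2 - Real.sqrt 2) ∧
        Summable (fun s : ℕ => c (s + 1) * t ^ (s + 1)) := by
  intro t ht hT
  have hr : Real.sqrt 2 ^ 2 = 2 := Real.sq_sqrt (by norm_num)
  have hr0 : 0 < Real.sqrt 2 := by positivity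
  have ha : ∀ s, 1 ≤ s → 0 ≤ c s * t ^ s := fun s hs => mul_nonneg (hc s hs) (pow_nonneg ht s)
  have hreca : ∀ s, 2 ≤ s → c s * t ^ s ≤
      1 / Real.sqrt 2 * ∑ m ∈ Finset.Ioo 0 s, c m * t ^ m * (c (s - m) * t ^ (s - m)) +
      1 / 6 * ∑ l ∈ Finset.Ioo 0 s, c l * t ^ l *
        ∑ m ∈ Finset.Ioo 0 (s - l), c m * t ^ m * (c (s - l - m) * t ^ (s - l - m)) := by
    intro s hs
    refine (mul_le_mul_of_nonneg_right (hrec s hs) (pow_nonneg ht s)).trans_eq ?_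
    rw [add_mul, mul_assoc, mul_assoc, Finset.sum_mul, Finset.sum_mul]
    congr 2
    · refine Finset.sum_congr rfl fun m hm => ?_
      obtain ⟨k, rfl⟩ := Nat.exists_eq_add_of_lt (Finset.mem_Ioo.1 hm).2
      rw [show m + k + 1 - m = k + 1 by omega]
      ring
    · refine Finset.sum_congr rfl fun l hl => ?_
      obtain ⟨k, rfl⟩ := Nat.exists_eq_add_of_lt (Finset.mem_Ioo.1 hl).2
      rw [show l + k + 1 - l = k + 1 by omega, Finset.sum_mul, Finset.mul_sum]
      refine Finset.sum_congr rfl fun m hm => ?_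
      obtain ⟨j, hj⟩ := Nat.exists_eq_add_of_lt (Finset.mem_Ioo.1 hm).2
      rw [add_assoc l k 1, hj, show m + j + 1 - m = j + 1 by omega]
      ring
  have hfirst : c 1 * t ^ 1 ≤ (8 - 5 * Real.sqrt 2) / 3 := by
    rw [pow_one]
    exact (mul_le_mul_of_nonneg_right h1 ht).trans hT.le
  have hfix : (8 - 5 * Real.sqrt 2) / 3 + 1 / Real.sqrt 2 * (2 - Real.sqrt 2) ^ 2 +
      1 / 6 * (2 - Real.sqrt 2) ^ 3 = 2 - Real.sqrt 2 := by
    have hinv : 1 / Real.sqrt 2 = Real.sqrt 2 / 2 := by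
      field_simp
      linarith
    rw [hinv]
    linear_combination (-1 + Real.sqrt 2 / 3) * hr
  have hbound : ∀ N : ℕ, ∑ s ∈ Finset.Icc 1 N, c s * t ^ s ≤ 2 - Real.sqrt 2 := by
    intro N
    induction N with
    | zero => simp
    | succ N ih =>
      have hS : 0 ≤ ∑ s ∈ Finset.Icc 1 N, c s * t ^ s :=
        Finset.sum_nonneg fun s hs => ha s (Finset.mem_Icc.1 hs).1
      refine (sum_Icc_succ_le_of_recurrence (a := fun s => c s * t ^ s) (by positivity)
        (by norm_num) ha hreca N).trans (le_trans ?_ hfix.le)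
      gcongr
  refine ⟨fun N _ => hbound N, ?_⟩
  refine summable_of_sum_range_le (c := 2 - Real.sqrt 2) (fun s => ha _ s.succ_pos) fun N => ?_
  refine le_of_eq_of_le ?_ (hbound N)
  rw [Finset.range_eq_Ico, Finset.sum_Ico_add' (fun s => c s * t ^ s) 0 N 1]
  rfl
end

section
/- Let K > 0 and let (c_s)_{s≥1} be nonnegative real numbers with c_1 ≤ K and, for every s ≥ 2, c_s ≤ 12 Σ_{m=1}^{s−1} c_m c_{s−m} + 6 Σ_{l,m,n ≥ 1, l+m+n = s} c_l c_m c_n. Then for every t with 0 ≤ t ≤ 1/(50K), every partial sum satisfies Σ_{s=1}^{N} c_s t^s ≤ (3√2 − 4)/6 for all N ≥ 1; in particular the series Σ_{s=1}^{∞} c_s t^s converges. -/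
/-- Partial sums of a Cauchy product of sequences indexed from `1` are at most the product of
the partial sums. -/
theorem sum_Icc_sum_Ioo_mul_le (b d : ℕ → ℝ) (hb : ∀ s, 1 ≤ s → 0 ≤ b s)
    (hd : ∀ s, 1 ≤ s → 0 ≤ d s) (N : ℕ) :
    ∑ s ∈ Finset.Icc 1 (N + 1), ∑ m ∈ Finset.Ioo 0 s, b m * d (s - m)
      ≤ (∑ s ∈ Finset.Icc 1 N, b s) * ∑ s ∈ Finset.Icc 1 N, d s := by
  rw [Finset.sum_comm' (t' := Finset.Icc 1 N) (s' := fun m => Finset.Ioc m (N + 1))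
    (by intro x y; simp only [Finset.mem_Icc, Finset.mem_Ioo, Finset.mem_Ioc]; omega),
    Finset.sum_mul]
  refine Finset.sum_le_sum fun m hm => ?_
  rw [Finset.mem_Icc] at hm
  rw [← Finset.mul_sum]
  refine mul_le_mul_of_nonneg_left ?_ (hb m hm.1)
  have hinj : Set.InjOn (fun s => s - m) (Finset.Ioc m (N + 1) : Set ℕ) := by
    intro x hx y hy h
    simp only [Finset.coe_Ioc, Set.mem_Ioc] at hx hy h
    omega
  rw [← Finset.sum_image (f := d) hinj]
  refine Finset.sum_le_sum_of_subset_of_nonneg ?_ fun i hi _ => hd i (Finset.mem_Icc.1 hi).1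
  intro x hx
  simp only [Finset.mem_image, Finset.mem_Ioc, Finset.mem_Icc] at hx ⊢
  omega

/-- A nonnegative sequence whose terms are controlled by its quadratic and cubic Cauchy products
has partial sums satisfying the corresponding polynomial recurrence. -/
theorem sum_Icc_succ_le_of_cauchy_recurrence (a : ℕ → ℝ) (x : ℝ)
    (ha : ∀ s, 1 ≤ s → 0 ≤ a s) (h1 : a 1 ≤ x)
    (hrec : ∀ s, 2 ≤ s →
      a s ≤ 12 * ∑ m ∈ Finset.Ioo 0 s, a m * a (s - m)
        + 6 * ∑ l ∈ Finset.Ioo 0 s,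
            a l * ∑ m ∈ Finset.Ioo 0 (s - l), a m * a (s - l - m)) (N : ℕ) :
    ∑ s ∈ Finset.Icc 1 (N + 1), a s
      ≤ x + 12 * (∑ s ∈ Finset.Icc 1 N, a s) ^ 2 + 6 * (∑ s ∈ Finset.Icc 1 N, a s) ^ 3 := by
  set P : ℕ → ℝ := fun s => ∑ m ∈ Finset.Ioo 0 s, a m * a (s - m) with hP
  set S := ∑ s ∈ Finset.Icc 1 N, a s with hS
  have hP0 : ∀ s, 1 ≤ s → 0 ≤ P s := fun s _ => Finset.sum_nonneg fun m hm => by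
    rw [Finset.mem_Ioo] at hm
    exact mul_nonneg (ha _ (by omega)) (ha _ (by omega))
  have hS0 : 0 ≤ S := Finset.sum_nonneg fun i hi => ha i (Finset.mem_Icc.1 hi).1
  have hquad : ∑ s ∈ Finset.Icc 1 (N + 1), P s ≤ S * S := sum_Icc_sum_Ioo_mul_le a a ha ha N
  have hquad' : ∑ s ∈ Finset.Icc 1 N, P s ≤ S * S :=
    (Finset.sum_le_sum_of_subset_of_nonneg (Finset.Icc_subset_Icc_right N.le_succ)
      fun i hi _ => hP0 i (Finset.mem_Icc.1 hi).1).trans hquad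
  have hcub := (sum_Icc_sum_Ioo_mul_le a P ha hP0 N).trans
    (mul_le_mul_of_nonneg_left hquad' hS0)
  have hterm : ∀ s ∈ Finset.Icc 1 (N + 1), a s ≤ (if s = 1 then x else 0) + 12 * P s
      + 6 * ∑ l ∈ Finset.Ioo 0 s, a l * P (s - l) := by
    intro s hs
    rw [Finset.mem_Icc] at hs
    rcases hs.1.eq_or_lt with rfl | h
    · have hempty : Finset.Ioo 0 1 = (∅ : Finset ℕ) := rfl
      simpa [hP, hempty] using h1
    · simpa [show s ≠ 1 by omega] using hrec s h
  refine (Finset.sum_le_sum hterm).trans ?_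
  rw [Finset.sum_add_distrib, Finset.sum_add_distrib, ← Finset.mul_sum, ← Finset.mul_sum,
    Finset.sum_ite_eq' (Finset.Icc 1 (N + 1)) 1 fun _ => x,
    if_pos (Finset.mem_Icc.2 ⟨le_rfl, by omega⟩)]
  nlinarith

/-- The critical point of `ζ - 12 ζ² - 6 ζ³` is preserved as an upper bound by the polynomial
recurrence with source at most `1 / 50`. -/
theorem cubic_majorant_le {x S : ℝ} (hx : x ≤ 1 / 50) (hS : 0 ≤ S)
    (hSr : S ≤ (3 * Real.sqrt 2 - 4) / 6) :
    x + 12 * S ^ 2 + 6 * S ^ 3 ≤ (3 * Real.sqrt 2 - 4) / 6 := by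
  have hsq : Real.sqrt 2 ^ 2 = 2 := Real.sq_sqrt (by norm_num)
  have hlow : (1.4142 : ℝ) ≤ Real.sqrt 2 := Real.le_sqrt_of_sq_le (by norm_num)
  have hup : Real.sqrt 2 ≤ 1.4143 := Real.sqrt_le_iff.2 ⟨by norm_num, by norm_num⟩
  have h2 : S ^ 2 ≤ 0.0405 ^ 2 := pow_le_pow_left₀ hS (by linarith) 2
  have h3 : S ^ 3 ≤ 0.0405 ^ 3 := pow_le_pow_left₀ hS (by linarith) 3
  norm_num at h2 h3
  linarith

/-- Generating-function bound for the normed-space proof: if the coefficients `c_s`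
satisfy `c_1 ≤ K` and the recurrence of bounds with coefficients 12 and 6, then for
`0 ≤ t ≤ 1/(50K)` all partial sums of `Σ c_s t^s` are bounded by `(3√2 − 4)/6`, and
the series converges. -/
theorem normed_space_generating_function_bound (K : ℝ) (hK : 0 < K) (c : ℕ → ℝ)
    (hc : ∀ s : ℕ, 1 ≤ s → 0 ≤ c s) (h1 : c 1 ≤ K)
    (hrec : ∀ s : ℕ, 2 ≤ s →
      c s ≤ 12 * ∑ m ∈ Finset.Ioo 0 s, c m * c (s - m)
        + 6 * ∑ l ∈ Finset.Ioo 0 s, ∑ m ∈ Finset.Ioo 0 (s - l),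
            c l * c m * c (s - l - m)) :
    ∀ t : ℝ, 0 ≤ t → t ≤ 1 / (50 * K) →
      (∀ N : ℕ, 1 ≤ N →
          ∑ s ∈ Finset.Icc 1 N, c s * t ^ s ≤ (3 * Real.sqrt 2 - 4) / 6) ∧
        Summable (fun s : ℕ => c (s + 1) * t ^ (s + 1)) := by
  intro t ht htK
  have hx : K * t ≤ 1 / 50 := by
    rw [le_div_iff₀ (by positivity)] at htK
    linarith
  have ha : ∀ s, 1 ≤ s → 0 ≤ c s * t ^ s := fun s hs => mul_nonneg (hc s hs) (pow_nonneg ht s)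
  have hrec' : ∀ s, 2 ≤ s →
      c s * t ^ s ≤ 12 * ∑ m ∈ Finset.Ioo 0 s, (c m * t ^ m) * (c (s - m) * t ^ (s - m))
        + 6 * ∑ l ∈ Finset.Ioo 0 s, (c l * t ^ l) *
            ∑ m ∈ Finset.Ioo 0 (s - l),
              (c m * t ^ m) * (c (s - l - m) * t ^ (s - l - m)) := by
    intro s hs
    refine (mul_le_mul_of_nonneg_right (hrec s hs) (pow_nonneg ht s)).trans_eq ?_
    rw [add_mul, mul_assoc, mul_assoc, Finset.sum_mul, Finset.sum_mul]
    congr 2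
    · refine Finset.sum_congr rfl fun m hm => ?_
      rw [Finset.mem_Ioo] at hm
      rw [← pow_mul_pow_sub t hm.2.le]
      ring
    · refine Finset.sum_congr rfl fun l hl => ?_
      rw [Finset.mem_Ioo] at hl
      rw [Finset.sum_mul, Finset.mul_sum]
      refine Finset.sum_congr rfl fun m hm => ?_
      rw [Finset.mem_Ioo] at hm
      rw [← pow_mul_pow_sub t hl.2.le, ← pow_mul_pow_sub t hm.2.le]
      ring
  have hbound : ∀ N : ℕ,
      ∑ s ∈ Finset.Icc 1 N, c s * t ^ s ≤ (3 * Real.sqrt 2 - 4) / 6 := by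
    intro N
    induction N with
    | zero =>
      have hlow : (1.4142 : ℝ) ≤ Real.sqrt 2 := Real.le_sqrt_of_sq_le (by norm_num)
      rw [Finset.Icc_eq_empty (by norm_num), Finset.sum_empty]
      linarith
    | succ N ih =>
      exact (sum_Icc_succ_le_of_cauchy_recurrence (fun s => c s * t ^ s) (K * t) ha
        (by simpa using mul_le_mul_of_nonneg_right h1 ht) hrec' N).trans
        (cubic_majorant_le hx
          (Finset.sum_nonneg fun i hi => ha i (Finset.mem_Icc.1 hi).1) ih)
  refine ⟨fun N _ => hbound N,
    summable_of_sum_range_le (c := (3 * Real.sqrt 2 - 4) / 6) (fun s => ha _ (by omega))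
      fun n => ?_⟩
  refine le_of_eq_of_le ?_ (hbound n)
  rw [Finset.range_eq_Ico, Finset.sum_Ico_add' (fun s => c s * t ^ s) 0 n 1]
  rfl
end
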